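/- Let k, ℓ be integers with k ≥ 1 and 0 ≤ ℓ ≤ 2k−1, Γ a group, and α: 2^Γ → {0,1,…,ℓ} a normalized polymatroidal function satisfying the smoothness condition. Suppose the Γ-labeled graph (G,ψ) is near-balanced and f_α-full with β(E(G)) ≥ 2k−ℓ+1. Then the base vertex for the near-balancedness of (G,ψ) is unique. -/

import Mathlib

/- Formalization of count matroids of group-labeled graphs. -/

namespace CountMatroidPaper

attribute [local instance] Classical.propDecidable

/-- A `Γ`-labeled graph: a directed multigraph with edge set `E`, vertex set `V`,
and a gain (group label) on each edge. -/
structure GainGraph (V E Γ : Type*) where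
  tail : E → V
  head : E → V
  gain : E → Γ

variable {V E Γ : Type*}

namespace GainGraph

variable [Group Γ]

/-- `V(F)`: the set of vertices incident to the edge set `F`. -/
def verts [DecidableEq V] (G : GainGraph V E Γ) (F : Finset E) : Finset V :=
  F.image G.tail ∪ F.image G.head

/-- `G.GainWalk F u w g` : there is a walk from `u` to `w` using edges of `F` whose gain is `g`. -/
inductive GainWalk (G : GainGraph V E Γ) (F : Set E) (u : V) : V → Γ → Prop
  | nil : GainWalk G F u u 1
  | fwd {w : V} {g : Γ} {e : E} : GainWalk G F u w g → e ∈ F → G.tail e = w →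
      GainWalk G F u (G.head e) (g * G.gain e)
  | bwd {w : V} {g : Γ} {e : E} : GainWalk G F u w g → e ∈ F → G.head e = w →
      GainWalk G F u (G.tail e) (g * (G.gain e)⁻¹)

/-- An edge set is balanced if every closed walk in it has identity gain. -/
def Balanced (G : GainGraph V E Γ) (F : Set E) : Prop :=
  ∀ (v : V) (g : Γ), G.GainWalk F v v g → g = 1

/-- Membership in `C(G)` : a nonempty edge set `F` such that `(V(F), F)` is connected. -/
def Connected [DecidableEq V] (G : GainGraph V E Γ) (F : Finset E) : Prop :=
  F.Nonempty ∧ ∀ u ∈ G.verts F, ∀ w ∈ G.verts F, ∃ g : Γ, G.GainWalk (↑F) u w g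

/-- The set of gains of closed walks based at `v` using edges of `F`. -/
def gains (G : GainGraph V E Γ) (F : Set E) (v : V) : Set Γ :=
  {g | G.GainWalk F v v g}

/-- `α̃(F)`: the value of `α` on (a generating set of) the subgroup `⟨F⟩_{v,ψ}` for a
vertex `v ∈ V(F)`.  For a polymatroidal `α` (invariant under conjugation and under taking
generated subgroups) this is independent of the choice of `v`. -/
noncomputable def alphaTilde (α : Set Γ → ℤ) (G : GainGraph V E Γ) (F : Finset E) : ℤ :=
  if h : F.Nonempty then α (G.gains (↑F) (G.tail h.choose)) else 0

/-- Loops at `v`. -/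
def loopsAt (G : GainGraph V E Γ) (v : V) : Set E :=
  {e | G.tail e = v ∧ G.head e = v}

/-- Unbalanced (non-identity labeled) loops at `v`, i.e. `L_v \ L_v°`. -/
def unbalancedLoopsAt (G : GainGraph V E Γ) (v : V) : Set E :=
  {e | G.tail e = v ∧ G.head e = v ∧ G.gain e ≠ 1}

/-- `E_v`: edges incident to `v`. -/
def incidentAt (G : GainGraph V E Γ) (v : V) : Set E :=
  {e | G.tail e = v ∨ G.head e = v}

/-- Non-loop edges incident to `v`. -/
def nonloopAt (G : GainGraph V E Γ) (v : V) : Set E :=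
  {e | (G.tail e = v ∨ G.head e = v) ∧ G.tail e ≠ G.head e}

/-- The split of `(G,ψ)` at `v` with respect to the bipartition `{E₁, E₂}` of the non-loop
edges incident to `v`, where `B = E₂`: the vertex `v` is split into `v₁ = Sum.inl v` and
`v₂ = Sum.inr ()`; edges in `B` become incident to `v₂`, the remaining non-loop edges at `v`
to `v₁`; balanced loops at `v` stay loops at `v₁`, and unbalanced loops at `v` become arcs
from `v₁` to `v₂`, keeping the labeling. -/
noncomputable def split (G : GainGraph V E Γ) (v : V) (B : Set E) :
    GainGraph (V ⊕ Unit) E Γ where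
  tail e :=
    if G.tail e = v ∧ G.head e = v then Sum.inl v
    else if G.tail e = v ∧ e ∈ B then Sum.inr ()
    else Sum.inl (G.tail e)
  head e :=
    if G.tail e = v ∧ G.head e = v then
      (if G.gain e = 1 then Sum.inl v else Sum.inr ())
    else if G.head e = v ∧ e ∈ B then Sum.inr ()
    else Sum.inl (G.head e)
  gain := G.gain

/-- `v` is a base for the near-balancedness of `F`, witnessed by the part `B` of the
bipartition of the non-loop edges at `v`: the corresponding split makes `F` balanced. -/
def IsSplitBase (G : GainGraph V E Γ) (F : Finset E) (v : V) (B : Set E) : Prop :=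
  B ⊆ G.nonloopAt v ∧ Balanced (G.split v B) (↑F)

/-- A connected edge set is near-balanced if it is unbalanced and some split of `(G,ψ)`
makes it balanced. -/
def NearBalanced (G : GainGraph V E Γ) (F : Finset E) : Prop :=
  ¬ G.Balanced (↑F) ∧ ∃ (v : V) (B : Set E), G.IsSplitBase F v B

/-- `K` is an extra edge set for the near-balancedness of `F` with base `v`:
`K = E₂ ∪ (L_v \ L_v°)` (or `E₁ ∪ (L_v \ L_v°)`) for a balanced split at `v` with
bipartition `{E₁, E₂}`. -/
def ExtraEdgeSet (G : GainGraph V E Γ) (F : Finset E) (v : V) (K : Set E) : Prop :=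
  ∃ B : Set E, G.IsSplitBase F v B ∧
    (K = B ∪ G.unbalancedLoopsAt v ∨
     K = (G.nonloopAt v \ B) ∪ G.unbalancedLoopsAt v)

/-- `β(F)`. -/
noncomputable def beta (α : Set Γ → ℤ) (k : ℤ) [DecidableEq V]
    (G : GainGraph V E Γ) (F : Finset E) : ℤ :=
  if G.NearBalanced F then min (alphaTilde α G F) k else alphaTilde α G F

/-- `f_α(F) = k|V(F)| - ℓ + β(F)`. -/
noncomputable def fAlpha (α : Set Γ → ℤ) (k ℓ : ℤ) [DecidableEq V]
    (G : GainGraph V E Γ) (F : Finset E) : ℤ :=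
  k * ((G.verts F).card : ℤ) - ℓ + beta α k G F

/-- `I` is `f_α`-sparse: `|F| ≤ f_α(F)` for every `F ∈ C(G)` with `F ⊆ I`. -/
def Sparse (α : Set Γ → ℤ) (k ℓ : ℤ) [DecidableEq V]
    (G : GainGraph V E Γ) (I : Finset E) : Prop :=
  ∀ F : Finset E, F ⊆ I → G.Connected F → (F.card : ℤ) ≤ fAlpha α k ℓ G F

/-- `F` is `f_α`-tight: connected, `f_α`-sparse, with `|F| = f_α(F)`. -/
def Tight (α : Set Γ → ℤ) (k ℓ : ℤ) [DecidableEq V]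
    (G : GainGraph V E Γ) (F : Finset E) : Prop :=
  G.Connected F ∧ Sparse α k ℓ G F ∧ (F.card : ℤ) = fAlpha α k ℓ G F

/-- An edge set `Y` is `f_α`-full: the subgraph `(V(Y), Y)` contains a spanning connected
`f_α`-sparse subgraph `G'` with `β(E(G')) = β(Y)` and
`|E(G')| ≥ k|V(G')| - ℓ + min{β(E(G')), 2k - ℓ + 1}`. -/
def Full (α : Set Γ → ℤ) (k ℓ : ℤ) [DecidableEq V]
    (G : GainGraph V E Γ) (Y : Finset E) : Prop :=
  ∃ E' : Finset E, E' ⊆ Y ∧ G.Connected E' ∧ G.verts E' = G.verts Y ∧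
    Sparse α k ℓ G E' ∧ beta α k G E' = beta α k G Y ∧
    k * ((G.verts E').card : ℤ) - ℓ + min (beta α k G E') (2 * k - ℓ + 1) ≤ (E'.card : ℤ)

/-- The graph `(G,ψ)` is `f_α`-full: it contains a spanning connected `f_α`-sparse
subgraph `G'` with `β(E(G')) = β(E(G))` and
`|E(G')| ≥ k|V(G')| - ℓ + min{β(E(G')), 2k - ℓ + 1}`. -/
def FullGraph [Fintype V] [Fintype E] [DecidableEq V]
    (α : Set Γ → ℤ) (k ℓ : ℤ) (G : GainGraph V E Γ) : Prop :=
  ∃ E' : Finset E, G.Connected E' ∧ G.verts E' = Finset.univ ∧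
    Sparse α k ℓ G E' ∧ beta α k G E' = beta α k G (Finset.univ : Finset E) ∧
    k * ((G.verts E').card : ℤ) - ℓ + min (beta α k G E') (2 * k - ℓ + 1) ≤ (E'.card : ℤ)

/-- `F` is `α`-critical: connected, near-balanced, and `α̃(F) > k`. -/
def AlphaCritical (α : Set Γ → ℤ) (k : ℤ) [DecidableEq V]
    (G : GainGraph V E Γ) (F : Finset E) : Prop :=
  G.Connected F ∧ G.NearBalanced F ∧ k < alphaTilde α G F

/-- Switching at `v` with `g`. -/
noncomputable def switch (G : GainGraph V E Γ) (v : V) (g : Γ) : GainGraph V E Γ where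
  tail := G.tail
  head := G.head
  gain e :=
    if G.tail e = v ∧ G.head e = v then g * G.gain e * g⁻¹
    else if G.tail e = v then g * G.gain e
    else if G.head e = v then G.gain e * g⁻¹
    else G.gain e

/-- Two gain functions (on the same underlying graph) are equivalent if one is obtained
from the other by a sequence of switchings. -/
def Equivalent (G G' : GainGraph V E Γ) : Prop :=
  Relation.ReflTransGen (fun H H' : GainGraph V E Γ => ∃ (v : V) (g : Γ), H' = H.switch v g) G G'

/-- The label of the edge `e`, re-oriented so that `e` is directed towards `v`. -/
noncomputable def orientTo (G : GainGraph V E Γ) (v : V) (e : E) : Γ :=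
  if G.head e = v then G.gain e else (G.gain e)⁻¹

/-- Adjacency in `G - v`. -/
def AdjAvoid (G : GainGraph V E Γ) (v u w : V) : Prop :=
  u ≠ v ∧ w ≠ v ∧ ∃ e : E, (G.tail e = u ∧ G.head e = w) ∨ (G.tail e = w ∧ G.head e = u)

/-- `S` is (the edge set of) a fraction of `v`: the subgraph of `G - L_v` induced by `v`
together with the vertex set of a connected component of `G - v`. -/
def IsFraction [Fintype E] (G : GainGraph V E Γ) (v : V) (S : Finset E) : Prop :=
  ∃ u : V, u ≠ v ∧
    S = Finset.univ.filter (fun e =>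
      ¬ (G.tail e = v ∧ G.head e = v) ∧
      (G.tail e = v ∨ Relation.ReflTransGen (G.AdjAvoid v) u (G.tail e)) ∧
      (G.head e = v ∨ Relation.ReflTransGen (G.AdjAvoid v) u (G.head e)))

/-- `I` is `(k,m)`-sparse: `|F| ≤ k|V(F)| - m` for every nonempty `F ⊆ I`. -/
def CountSparse [DecidableEq V] (G : GainGraph V E Γ) (k m : ℤ) (I : Finset E) : Prop :=
  ∀ F : Finset E, F ⊆ I → F.Nonempty → (F.card : ℤ) ≤ k * ((G.verts F).card : ℤ) - m

/-- `C` is a circuit of the `(k,m)`-count matroid `M_{k,m}(G)`: a minimal set that is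
not `(k,m)`-sparse. -/
def CountCircuit [DecidableEq V] (G : GainGraph V E Γ) (k m : ℤ) (C : Finset E) : Prop :=
  ¬ G.CountSparse k m C ∧ ∀ C' : Finset E, C' ⊆ C → C' ≠ C → G.CountSparse k m C'

end GainGraph

/-- `α : 2^Γ → ℤ` is polymatroidal. -/
structure Polymatroidal [Group Γ] (α : Set Γ → ℤ) : Prop where
  empty : α ∅ = 0
  submodular : ∀ X Y : Set Γ, α (X ∪ Y) + α (X ∩ Y) ≤ α X + α Y
  mono : ∀ X Y : Set Γ, X ⊆ Y → α X ≤ α Y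
  conj : ∀ (X : Set Γ) (γ : Γ), α ((fun x => γ * x * γ⁻¹) '' X) = α X
  clos : ∀ X : Set Γ, α ((Subgroup.closure X : Subgroup Γ) : Set Γ) = α X

/-- A polymatroidal function is normalized if `α({g}) ≠ 0` for every non-identity `g`
and `α({1}) = 0`. -/
def Normalized [Group Γ] (α : Set Γ → ℤ) : Prop :=
  (∀ g : Γ, g ≠ 1 → α {g} ≠ 0) ∧ α ({1} : Set Γ) = 0

/-- The smoothness condition: `α(S ∪ {g}) - α(S) > k` implies `S = {1}` and `g² ≠ 1`. -/
def Smooth [Group Γ] (α : Set Γ → ℤ) (k : ℤ) : Prop :=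
  ∀ (S : Set Γ) (g : Γ), S.Nonempty → k < α (S ∪ {g}) - α S →
    S = ({1} : Set Γ) ∧ g ^ 2 ≠ 1

namespace GainGraph

variable [Group Γ]

/-- The edge `e`, traversed from `a` to `b`, contributes the gain `h`. -/
def Joins (G : GainGraph V E Γ) (e : E) (a b : V) (h : Γ) : Prop :=
  (G.tail e = a ∧ G.head e = b ∧ h = G.gain e) ∨
    (G.head e = a ∧ G.tail e = b ∧ h = (G.gain e)⁻¹)

lemma Joins.symm {G : GainGraph V E Γ} {e : E} {a b : V} {h : Γ} (hj : G.Joins e a b h) :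
    G.Joins e b a h⁻¹ := by
  rcases hj with ⟨h1, h2, rfl⟩ | ⟨h1, h2, rfl⟩
  · exact Or.inr ⟨h2, h1, rfl⟩
  · exact Or.inl ⟨h2, h1, inv_inv _⟩

lemma joins_tail_head (G : GainGraph V E Γ) (e : E) :
    G.Joins e (G.tail e) (G.head e) (G.gain e) :=
  Or.inl ⟨rfl, rfl, rfl⟩

namespace GainWalk

variable {G : GainGraph V E Γ} {F F' : Set E} {u w x : V} {g h : Γ}

lemma snoc {e : E} (hw : G.GainWalk F u w g) (he : e ∈ F) (hj : G.Joins e w x h) :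
    G.GainWalk F u x (g * h) := by
  rcases hj with ⟨h1, rfl, rfl⟩ | ⟨h1, rfl, rfl⟩
  · exact hw.fwd he h1
  · exact hw.bwd he h1

lemma step_induction {P : V → Γ → Prop} (hnil : P u 1)
    (hsnoc : ∀ (w x : V) (g h : Γ) (e : E), G.GainWalk F u w g → P w g → e ∈ F →
      G.Joins e w x h → P x (g * h))
    (hw : G.GainWalk F u w g) : P w g := by
  induction hw with
  | nil => exact hnil
  | fwd hw he ht ih => exact hsnoc _ _ _ _ _ hw ih he (Or.inl ⟨ht, rfl, rfl⟩)
  | bwd hw he ht ih => exact hsnoc _ _ _ _ _ hw ih he (Or.inr ⟨ht, rfl, rfl⟩)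

lemma trans (h₁ : G.GainWalk F u w g) (h₂ : G.GainWalk F w x h) :
    G.GainWalk F u x (g * h) := by
  refine step_induction (P := fun x h => G.GainWalk F u x (g * h)) (by simpa using h₁) ?_ h₂
  intro y z g' h' e _ ih he hj
  rw [← mul_assoc]
  exact ih.snoc he hj

lemma symm (hw : G.GainWalk F u w g) : G.GainWalk F w u g⁻¹ := by
  refine step_induction (P := fun w g => G.GainWalk F w u g⁻¹) (by simpa using nil) ?_ hw
  intro y z g' h' e _ ih he hj
  rw [mul_inv_rev]
  simpa using (nil.snoc he hj.symm).trans ih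

lemma mono (hF : F ⊆ F') (hw : G.GainWalk F u w g) : G.GainWalk F' u w g :=
  step_induction (P := fun w g => G.GainWalk F' u w g) nil
    (fun _ _ _ _ _ _ ih he hj => ih.snoc (hF he) hj) hw

lemma map {V' : Type*} {H : GainGraph V' E Γ} (φ : V → V')
    (hφ : ∀ e ∈ F, H.tail e = φ (G.tail e) ∧ H.head e = φ (G.head e) ∧ H.gain e = G.gain e)
    (hw : G.GainWalk F u w g) : H.GainWalk F (φ u) (φ w) g := by
  refine step_induction (P := fun w g => H.GainWalk F (φ u) (φ w) g) nil ?_ hw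
  intro y z g' h' e _ ih he hj
  obtain ⟨ht, hh, hg⟩ := hφ e he
  refine ih.snoc he ?_
  rcases hj with ⟨rfl, rfl, rfl⟩ | ⟨rfl, rfl, rfl⟩
  · exact Or.inl ⟨ht, hh, hg.symm⟩
  · exact Or.inr ⟨hh, ht, by rw [hg]⟩

end GainWalk

lemma Balanced.mono {G : GainGraph V E Γ} {F F' : Set E} (hb : G.Balanced F') (hF : F ⊆ F') :
    G.Balanced F :=
  fun v g hw => hb v g (hw.mono hF)

lemma Balanced.of_map {V' : Type*} {G : GainGraph V E Γ} {H : GainGraph V' E Γ} {F : Set E}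
    (hb : H.Balanced F) (φ : V → V')
    (hφ : ∀ e ∈ F, H.tail e = φ (G.tail e) ∧ H.head e = φ (G.head e) ∧ H.gain e = G.gain e) :
    G.Balanced F :=
  fun v g hw => hb (φ v) g (hw.map φ hφ)

lemma Connected.of_root [DecidableEq V] {G : GainGraph V E Γ} {F : Finset E} (hF : F.Nonempty)
    (r : V) (hr : ∀ e ∈ F, ∃ g, G.GainWalk (↑F) r (G.tail e) g) : G.Connected F := by
  have hall : ∀ x ∈ G.verts F, ∃ g, G.GainWalk (↑F) r x g := by
    intro x hx
    simp only [verts, Finset.mem_union, Finset.mem_image] at hx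
    rcases hx with ⟨e, he, rfl⟩ | ⟨e, he, rfl⟩
    · exact hr e he
    · obtain ⟨g, hg⟩ := hr e he
      exact ⟨_, hg.snoc (Finset.mem_coe.2 he) (G.joins_tail_head e)⟩
  refine ⟨hF, fun x hx y hy => ?_⟩
  obtain ⟨g, hg⟩ := hall x hx
  obtain ⟨h, hh⟩ := hall y hy
  exact ⟨_, hg.symm.trans hh⟩

/-- The projection from the vertices of a split at `v` to the original vertices. -/
def splitProj (v : V) : V ⊕ Unit → V := Sum.elim id fun _ => v

lemma splitProj_eq_iff {v w : V} {y : V ⊕ Unit} :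
    splitProj v y = w ↔ y = Sum.inl w ∨ (y = Sum.inr () ∧ v = w) := by
  rcases y with y | ⟨⟩ <;> simp [splitProj]

lemma splitProj_tail (G : GainGraph V E Γ) (v : V) (B : Set E) (e : E) :
    splitProj v ((G.split v B).tail e) = G.tail e := by
  simp only [split]
  split_ifs with h1 h2 <;> simp_all [splitProj]

lemma splitProj_head (G : GainGraph V E Γ) (v : V) (B : Set E) (e : E) :
    splitProj v ((G.split v B).head e) = G.head e := by
  simp only [split]
  split_ifs with h1 h2 <;> simp_all [splitProj]

lemma splitProj_joins {G : GainGraph V E Γ} {v : V} {B : Set E} {e : E} {y z : V ⊕ Unit} {h : Γ}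
    (hj : (G.split v B).Joins e y z h) : G.Joins e (splitProj v y) (splitProj v z) h := by
  rcases hj with ⟨rfl, rfl, rfl⟩ | ⟨rfl, rfl, rfl⟩
  · exact Or.inl ⟨(G.splitProj_tail v B e).symm, (G.splitProj_head v B e).symm, rfl⟩
  · exact Or.inr ⟨(G.splitProj_head v B e).symm, (G.splitProj_tail v B e).symm, rfl⟩

lemma exists_joins_split {G : GainGraph V E Γ} (v : V) (B : Set E) {e : E} {a b : V} {h : Γ}
    (hj : G.Joins e a b h) :
    ∃ y z, splitProj v y = a ∧ splitProj v z = b ∧ (G.split v B).Joins e y z h := by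
  rcases hj with ⟨rfl, rfl, rfl⟩ | ⟨rfl, rfl, rfl⟩
  · exact ⟨_, _, G.splitProj_tail v B e, G.splitProj_head v B e, Or.inl ⟨rfl, rfl, rfl⟩⟩
  · exact ⟨_, _, G.splitProj_head v B e, G.splitProj_tail v B e, Or.inr ⟨rfl, rfl, rfl⟩⟩

lemma GainWalk.proj {G : GainGraph V E Γ} {v : V} {B F : Set E} {y z : V ⊕ Unit} {g : Γ}
    (hw : (G.split v B).GainWalk F y z g) : G.GainWalk F (splitProj v y) (splitProj v z) g :=
  hw.map _ fun e _ => ⟨(G.splitProj_tail v B e).symm, (G.splitProj_head v B e).symm, rfl⟩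

/-- The edges avoiding a base are balanced. -/
lemma Balanced.avoid {G : GainGraph V E Γ} {u : V} {C F : Set E}
    (hb : (G.split u C).Balanced F) :
    G.Balanced {e | e ∈ F ∧ G.tail e ≠ u ∧ G.head e ≠ u} := by
  refine (hb.mono (fun e he => he.1)).of_map Sum.inl fun e he => ⟨?_, ?_, rfl⟩
  · simp [split, he.2.1]
  · simp [split, he.2.1, he.2.2]

/-- If a split of a connected unbalanced graph is balanced, then the two copies of the split
vertex are joined by a walk of non-identity gain. -/
lemma exists_walk_split {G : GainGraph V E Γ} {v : V} {B F : Set E}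
    (hb : (G.split v B).Balanced F) (hconn : ∀ x, ∃ g, G.GainWalk F v x g)
    (hun : ¬ G.Balanced F) :
    ∃ g, g ≠ 1 ∧ (G.split v B).GainWalk F (Sum.inl v) (Sum.inr ()) g := by
  by_contra! hno
  have hone : ∀ (y z : V ⊕ Unit) (g : Γ), splitProj v y = v → splitProj v z = v →
      (G.split v B).GainWalk F y z g → g = 1 := by
    intro y z g hy hz hw
    have hlr : ∀ g, (G.split v B).GainWalk F (Sum.inl v) (Sum.inr ()) g → g = 1 :=
      fun g hw => by_contra fun hg => hno g hg hw
    rcases splitProj_eq_iff.1 hy with rfl | ⟨rfl, -⟩ <;>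
      rcases splitProj_eq_iff.1 hz with rfl | ⟨rfl, -⟩
    · exact hb _ _ hw
    · exact hlr _ hw
    · simpa using hlr _ hw.symm
    · exact hb _ _ hw
  have hlift : ∀ w g, G.GainWalk F v w g → ∃ y z, splitProj v y = v ∧ splitProj v z = w ∧
      (G.split v B).GainWalk F y z g := by
    intro w g hw
    refine GainWalk.step_induction (P := fun w g => ∃ y z, splitProj v y = v ∧
      splitProj v z = w ∧ (G.split v B).GainWalk F y z g)
      ⟨Sum.inl v, Sum.inl v, rfl, rfl, .nil⟩ ?_ hw
    rintro w x g h e - ⟨y, z, hy, hz, hyz⟩ he hj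
    obtain ⟨a, b, ha, hb', hab⟩ := exists_joins_split v B hj
    by_cases haz : a = z
    · subst haz
      exact ⟨y, b, hy, hb', hyz.snoc he hab⟩
    · have hwv : w = v := by
        rcases splitProj_eq_iff.1 ha with h1 | ⟨h1, h2⟩
        · rcases splitProj_eq_iff.1 hz with h3 | ⟨h3, h4⟩
          · exact absurd (h1.trans h3.symm) haz
          · exact h4.symm
        · exact h2.symm
      have hg : g = 1 := hone y z g hy (hz.trans hwv) hyz
      refine ⟨a, b, ha.trans hwv, hb', ?_⟩
      rw [hg]
      exact GainWalk.nil.snoc he hab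
  refine hun fun x g hw => ?_
  obtain ⟨h, hh⟩ := hconn x
  obtain ⟨y, z, hy, hz, hyz⟩ := hlift v _ ((hh.trans hw).trans hh.symm)
  simpa using hone y z _ hy hz hyz

/-- If the two copies of the split vertex are joined, a split of a connected graph is
connected. -/
lemma split_reachable {G : GainGraph V E Γ} {v : V} {B F : Set E}
    (hconn : ∀ x, ∃ g, G.GainWalk F v x g) {g₀ : Γ}
    (hv : (G.split v B).GainWalk F (Sum.inl v) (Sum.inr ()) g₀) (y : V ⊕ Unit) :
    ∃ g, (G.split v B).GainWalk F (Sum.inl v) y g := by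
  have hbase : ∀ y, splitProj v y = v → ∃ g, (G.split v B).GainWalk F (Sum.inl v) y g := by
    intro y hy
    rcases splitProj_eq_iff.1 hy with rfl | ⟨rfl, -⟩
    · exact ⟨1, .nil⟩
    · exact ⟨g₀, hv⟩
  have hlift : ∀ w g, G.GainWalk F v w g → ∀ y, splitProj v y = w →
      ∃ g, (G.split v B).GainWalk F (Sum.inl v) y g := by
    intro w g hw
    refine GainWalk.step_induction (P := fun w _ => ∀ y, splitProj v y = w →
      ∃ g, (G.split v B).GainWalk F (Sum.inl v) y g) hbase ?_ hw
    intro w x g h e _ ih he hj y hy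
    by_cases hxv : x = v
    · exact hbase y (hy.trans hxv)
    obtain ⟨a, b, ha, hb, hab⟩ := exists_joins_split v B hj
    have hby : b = y := by
      have hxv' : v ≠ x := fun h => hxv h.symm
      have h1 := splitProj_eq_iff.1 hb
      have h2 := splitProj_eq_iff.1 hy
      simp only [hxv', and_false, or_false] at h1 h2
      rw [h1, h2]
    subst hby
    obtain ⟨g', hg'⟩ := ih a ha
    exact ⟨_, hg'.snoc he hab⟩
  obtain ⟨g, hg⟩ := hconn (splitProj v y)
  exact hlift _ g hg y rfl

/-- A connected unbalanced spanning edge set with two distinct bases `u`, `v` is the disjoint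
union of two connected balanced edge sets which share no vertices other than `u` and `v`. -/
lemma exists_balanced_decomposition [DecidableEq V] [DecidableEq E] {G : GainGraph V E Γ}
    {F : Finset E} {u v : V} {B C : Set E} (huv : u ≠ v)
    (hconn : ∀ x, ∃ g, G.GainWalk (↑F) v x g) (hun : ¬ G.Balanced (↑F))
    (hv : (G.split v B).Balanced (↑F)) (hu : (G.split u C).Balanced (↑F)) :
    ∃ F₁ F₂ : Finset E, Disjoint F₁ F₂ ∧ F₁ ∪ F₂ = F ∧ G.Connected F₁ ∧ G.Connected F₂ ∧
      G.Balanced (↑F₁) ∧ G.Balanced (↑F₂) ∧ G.verts F₁ ∩ G.verts F₂ ⊆ {u, v} := by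
  obtain ⟨g₀, hg₀, hw₀⟩ := exists_walk_split hv hconn hun
  set H := G.split v B
  set A : Set E := {e | e ∈ (↑F : Set E) ∧ G.tail e ≠ u ∧ G.head e ≠ u}
  set S : Set (V ⊕ Unit) := {y | ∃ g, H.GainWalk A (Sum.inl v) y g}
  have hAF : A ⊆ (↑F : Set E) := fun e he => he.1
  have hvS : Sum.inl v ∈ S := ⟨1, .nil⟩
  have hrS : Sum.inr () ∉ S := by
    rintro ⟨g, hg⟩
    have h1 : g = 1 := hu.avoid v g hg.proj
    have h2 := hv _ _ (hw₀.trans (hg.mono hAF).symm)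
    rw [h1] at h2
    exact hg₀ (by simpa using h2)
  have hSu : ∀ y ∈ S, splitProj v y ≠ u := by
    rintro y ⟨g, hg⟩
    refine GainWalk.step_induction (P := fun y _ => splitProj v y ≠ u)
      (show splitProj v (Sum.inl v) ≠ u from huv.symm) ?_ hg
    intro a b g h e _ _ he hj
    rcases splitProj_joins hj with ⟨-, h2, -⟩ | ⟨-, h2, -⟩
    · exact h2 ▸ he.2.2
    · exact h2 ▸ he.2.1
  have hstep : ∀ e ∈ F, ∀ y z h, H.Joins e y z h → y ∈ S → z ∈ S ∨ z = Sum.inl u := by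
    intro e he y z h hj hy
    by_cases hz : splitProj v z = u
    · right
      simpa [huv.symm] using splitProj_eq_iff.1 hz
    · left
      have heA : e ∈ A := by
        have hyu := hSu y hy
        rcases splitProj_joins hj with ⟨h1, h2, -⟩ | ⟨h1, h2, -⟩
        · exact ⟨he, h1 ▸ hyu, h2 ▸ hz⟩
        · exact ⟨he, h2 ▸ hz, h1 ▸ hyu⟩
      obtain ⟨g, hg⟩ := hy
      exact ⟨_, hg.snoc heA hj⟩
  set F₁ : Finset E := F.filter (fun e => H.tail e ∈ S ∨ H.head e ∈ S)
  set F₂ : Finset E := F.filter (fun e => ¬ (H.tail e ∈ S ∨ H.head e ∈ S))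
  have hmem₁ : ∀ e, e ∈ F₁ ↔ e ∈ F ∧ (H.tail e ∈ S ∨ H.head e ∈ S) := fun e =>
    Finset.mem_filter
  have hmem₂ : ∀ e, e ∈ F₂ ↔ e ∈ F ∧ ¬ (H.tail e ∈ S ∨ H.head e ∈ S) := fun e =>
    Finset.mem_filter
  have hjoin₁ : ∀ e ∈ F, ∀ y z h, H.Joins e y z h → (y ∈ S ∨ z ∈ S) → e ∈ F₁ := by
    intro e he y z h hj hyz
    rw [hmem₁]
    rcases hj with ⟨h1, h2, -⟩ | ⟨h1, h2, -⟩ <;> rw [h1, h2]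
    · exact ⟨he, hyz⟩
    · exact ⟨he, hyz.symm⟩
  have hends₁ : ∀ e ∈ F₁, (H.tail e ∈ S ∨ H.tail e = Sum.inl u) ∧
      (H.head e ∈ S ∨ H.head e = Sum.inl u) := by
    intro e he
    obtain ⟨heF, h | h⟩ := (hmem₁ e).1 he
    · exact ⟨Or.inl h, hstep e heF _ _ _ (H.joins_tail_head e) h⟩
    · exact ⟨hstep e heF _ _ _ (H.joins_tail_head e).symm h, Or.inl h⟩
  have hends₂ : ∀ e ∈ F₂, H.tail e ∉ S ∧ H.head e ∉ S := fun e he => by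
    simpa only [not_or] using ((hmem₂ e).1 he).2
  have hbal₁ : G.Balanced (↑F₁) := by
    refine (hv.mono (Finset.coe_subset.2 (Finset.filter_subset _ _))).of_map Sum.inl
      fun e he => ?_
    have hpr : ∀ y : V ⊕ Unit, (y ∈ S ∨ y = Sum.inl u) → y = Sum.inl (splitProj v y) := by
      rintro (y | ⟨⟩) hy
      · rfl
      · exact absurd hy (by simp [hrS])
    obtain ⟨ht, hh⟩ := hends₁ e he
    refine ⟨?_, ?_, rfl⟩
    · rw [← G.splitProj_tail v B e]; exact hpr _ ht
    · rw [← G.splitProj_head v B e]; exact hpr _ hh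
  have hbal₂ : G.Balanced (↑F₂) := by
    refine (hv.mono (Finset.coe_subset.2 (Finset.filter_subset _ _))).of_map
      (fun x => if x = v then Sum.inr () else Sum.inl x) fun e he => ?_
    have hpr : ∀ y : V ⊕ Unit, y ∉ S →
        y = if splitProj v y = v then Sum.inr () else Sum.inl (splitProj v y) := by
      rintro (y | ⟨⟩) hy
      · have hyv : y ≠ v := by rintro rfl; exact hy hvS
        simp [splitProj, hyv]
      · simp [splitProj]
    obtain ⟨ht, hh⟩ := hends₂ e he
    refine ⟨?_, ?_, rfl⟩
    · rw [← G.splitProj_tail v B e]; exact hpr _ ht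
    · rw [← G.splitProj_head v B e]; exact hpr _ hh
  have hunion : F₁ ∪ F₂ = F := Finset.filter_union_filter_not_eq _ _
  have hne₁ : F₁.Nonempty := by
    by_contra hne
    rw [Finset.not_nonempty_iff_eq_empty] at hne
    rw [hne, Finset.empty_union] at hunion
    exact hun (hunion ▸ hbal₂)
  have hne₂ : F₂.Nonempty := by
    by_contra hne
    rw [Finset.not_nonempty_iff_eq_empty] at hne
    rw [hne, Finset.union_empty] at hunion
    exact hun (hunion ▸ hbal₁)
  have hreach₁ : ∀ y ∈ S, ∃ g, H.GainWalk (↑F₁) (Sum.inl v) y g := by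
    rintro y ⟨g, hg⟩
    refine ⟨g, GainWalk.step_induction (P := fun y g => H.GainWalk (↑F₁) (Sum.inl v) y g)
      .nil ?_ hg⟩
    intro a b g h e hw ih he hj
    exact ih.snoc (Finset.mem_coe.2 (hjoin₁ e he.1 _ _ _ hj (Or.inl ⟨g, hw⟩))) hj
  have hreach₂ : ∀ y ∉ S, ∃ g, H.GainWalk (↑F₂) (Sum.inl u) y g := by
    intro y hy
    obtain ⟨g, hg⟩ := split_reachable hconn hw₀ y
    refine (GainWalk.step_induction
      (P := fun y _ => y ∈ S ∨ ∃ g, H.GainWalk (↑F₂) (Sum.inl u) y g)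
      (Or.inl hvS) ?_ hg).resolve_left hy
    intro a b g h e _ ih he hj
    by_cases haS : a ∈ S
    · rcases hstep e he a b h hj haS with hb | rfl
      · exact Or.inl hb
      · exact Or.inr ⟨1, .nil⟩
    by_cases hbS : b ∈ S
    · exact Or.inl hbS
    obtain ⟨g', hg'⟩ := ih.resolve_left haS
    refine Or.inr ⟨_, hg'.snoc (Finset.mem_coe.2 ((hmem₂ e).2 ⟨he, ?_⟩)) hj⟩
    rw [not_or]
    rcases hj with ⟨rfl, rfl, -⟩ | ⟨rfl, rfl, -⟩
    · exact ⟨haS, hbS⟩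
    · exact ⟨hbS, haS⟩
  refine ⟨F₁, F₂, Finset.disjoint_filter_filter_not _ _ _, hunion,
    Connected.of_root hne₁ v fun e he => ?_, Connected.of_root hne₂ u fun e he => ?_,
    hbal₁, hbal₂, fun x hx => ?_⟩
  · rw [← G.splitProj_tail v B e]
    by_cases ht : H.tail e ∈ S
    · obtain ⟨g, hg⟩ := hreach₁ _ ht
      exact ⟨g, hg.proj⟩
    · obtain ⟨g, hg⟩ := hreach₁ _ (((hmem₁ e).1 he).2.resolve_left ht)
      exact ⟨_, (hg.snoc (Finset.mem_coe.2 he) (H.joins_tail_head e).symm).proj⟩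
  · rw [← G.splitProj_tail v B e]
    obtain ⟨g, hg⟩ := hreach₂ _ (hends₂ e he).1
    exact ⟨g, hg.proj⟩
  · by_contra hxuv
    simp only [Finset.mem_insert, Finset.mem_singleton, not_or] at hxuv
    have hlift : ∀ y : V ⊕ Unit, splitProj v y = x → y = Sum.inl x := by
      intro y hy
      simpa [Ne.symm hxuv.2] using splitProj_eq_iff.1 hy
    simp only [verts, Finset.mem_inter, Finset.mem_union, Finset.mem_image] at hx
    have hxS : Sum.inl x ∈ S := by
      rcases hx.1 with ⟨e, he, hex⟩ | ⟨e, he, hex⟩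
      · have h1 := (hends₁ e he).1
        rw [hlift _ ((G.splitProj_tail v B e).trans hex)] at h1
        simpa [hxuv.1] using h1
      · have h1 := (hends₁ e he).2
        rw [hlift _ ((G.splitProj_head v B e).trans hex)] at h1
        simpa [hxuv.1] using h1
    rcases hx.2 with ⟨e, he, hex⟩ | ⟨e, he, hex⟩
    · have h1 := (hends₂ e he).1
      rw [hlift _ ((G.splitProj_tail v B e).trans hex)] at h1
      exact h1 hxS
    · have h1 := (hends₂ e he).2
      rw [hlift _ ((G.splitProj_head v B e).trans hex)] at h1
      exact h1 hxS

lemma beta_le_alphaTilde [DecidableEq V] (α : Set Γ → ℤ) (k : ℤ) (G : GainGraph V E Γ)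
    (F : Finset E) : beta α k G F ≤ alphaTilde α G F := by
  unfold beta
  split_ifs
  · exact min_le_left _ _
  · exact le_rfl

lemma Balanced.alphaTilde_eq_zero {α : Set Γ → ℤ} (hα : α {1} = 0) {G : GainGraph V E Γ}
    {F : Finset E} (hb : G.Balanced (↑F)) : alphaTilde α G F = 0 := by
  have hgains : ∀ x, G.gains (↑F) x = {1} := fun x =>
    Set.eq_singleton_iff_unique_mem.2 ⟨.nil, fun g hg => hb x g hg⟩
  simp [alphaTilde, hgains, hα]

end GainGraph

/-- Lemma 2: if `(G,ψ)` is near-balanced and `f_α`-full with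
`β(E(G)) ≥ 2k - ℓ + 1`, then the base for the near-balancedness is unique. -/
theorem statement10 {V E Γ : Type} [Fintype V] [DecidableEq V] [Fintype E] [DecidableEq E]
    [Group Γ] (k ℓ : ℤ) (hk : 1 ≤ k) (hl0 : 0 ≤ ℓ) (hl : ℓ ≤ 2 * k - 1)
    (α : Set Γ → ℤ) (hpoly : Polymatroidal α) (hnorm : Normalized α)
    (hrange : ∀ X : Set Γ, 0 ≤ α X ∧ α X ≤ ℓ) (hsmooth : Smooth α k)
    (G : GainGraph V E Γ)
    (hconn : G.Connected (Finset.univ : Finset E))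
    (hnb : G.NearBalanced (Finset.univ : Finset E))
    (hfull : GainGraph.FullGraph α k ℓ G)
    (hbeta : 2 * k - ℓ + 1 ≤ GainGraph.beta α k G (Finset.univ : Finset E)) :
    ∃! v : V, ∃ B : Set E, G.IsSplitBase Finset.univ v B := by
  obtain ⟨hun, v, B, hvB⟩ := hnb
  refine ⟨v, ⟨B, hvB⟩, ?_⟩
  rintro u ⟨C, huC⟩
  by_contra huv
  obtain ⟨F, hFconn, hFverts, hFsparse, hFbeta, hFcard⟩ := hfull
  have hsub : (↑F : Set E) ⊆ ↑(Finset.univ : Finset E) := by simp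
  have hFun : ¬ G.Balanced (↑F) := by
    intro hb
    have h1 := GainGraph.beta_le_alphaTilde α k G F
    rw [hb.alphaTilde_eq_zero hnorm.2] at h1
    have h2 := (hrange Set.univ).1.trans (hrange Set.univ).2
    linarith
  obtain ⟨F₁, F₂, hdisj, hunion, hc₁, hc₂, hb₁, hb₂, hinter⟩ :=
    GainGraph.exists_balanced_decomposition huv
      (fun x => hFconn.2 v (by simp [hFverts]) x (by simp [hFverts])) hFun
      (hvB.2.mono hsub) (huC.2.mono hsub)
  have hle : ∀ F' ⊆ F, G.Connected F' → G.Balanced (↑F') →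
      (F'.card : ℤ) ≤ k * ((G.verts F').card : ℤ) - ℓ := by
    intro F' hF' hc hb
    have h1 := hFsparse F' hF' hc
    have h2 := GainGraph.beta_le_alphaTilde α k G F'
    rw [hb.alphaTilde_eq_zero hnorm.2] at h2
    unfold GainGraph.fAlpha at h1
    linarith
  have h₁ := hle F₁ (hunion ▸ Finset.subset_union_left) hc₁ hb₁
  have h₂ := hle F₂ (hunion ▸ Finset.subset_union_right) hc₂ hb₂
  have hcardF : (F.card : ℤ) = F₁.card + F₂.card := by
    rw [← hunion, Finset.card_union_of_disjoint hdisj]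
    push_cast
    rfl
  have hcardV : ((G.verts F₁).card : ℤ) + (G.verts F₂).card ≤ (G.verts F).card + 2 := by
    have h3 := Finset.card_union_add_card_inter (G.verts F₁) (G.verts F₂)
    have h4 : (G.verts F₁ ∪ G.verts F₂).card ≤ (G.verts F).card := by
      rw [hFverts]
      exact Finset.card_le_univ _
    have h5 := (Finset.card_le_card hinter).trans Finset.card_le_two
    omega
  rw [hFbeta, min_eq_right hbeta] at hFcard
  have h6 := mul_le_mul_of_nonneg_left hcardV (by linarith : (0 : ℤ) ≤ k)
  linarith

end CountMatroidPaper
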